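/- Let σ : Σ → Σ be a subshift of finite type, φ : Σ → ℚ^n a locally constant constraint, and A : Σ → ℝ a Walters potential. Take r ∈ φ_*(M_σ) ∩ ℚ^n, and assume there exists an ergodic (A,r)-maximizing probability measure with respect to which φ is joint recurrent. Then β_{A,φ}(r) = sup{∫A dμ : μ ∈ φ_*^{-1}(r), μ a periodic probability measure}. -/

import Mathlib

open MeasureTheory Filter Topology Set

/-- The left shift on the full shift space `{1,…,N}^ℕ`. -/
def Shift {N : ℕ} : (ℕ → Fin N) → (ℕ → Fin N) := fun x i => x (i + 1)

/-- `S` is a subshift of finite type: it is the set of sequences all of whose transitions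
are allowed by some transition relation `M`. -/
def IsSubshiftFT {N : ℕ} (S : Set (ℕ → Fin N)) : Prop :=
  ∃ M : Fin N → Fin N → Prop, S = {x | ∀ i, M (x i) (x (i + 1))}

/-- The Birkhoff sum `S_k f` for the shift. -/
def birkhoff {N : ℕ} {E : Type*} [AddCommMonoid E] (k : ℕ) (f : (ℕ → Fin N) → E)
    (x : ℕ → Fin N) : E :=
  ∑ j ∈ Finset.range k, f (Shift^[j] x)

open Classical in
/-- The metric `d(x,y) = λ^{min{j : x_j ≠ y_j}}` on the shift space. -/
noncomputable def sdist {N : ℕ} (lam : ℝ) (x y : ℕ → Fin N) : ℝ :=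
  if x = y then 0 else lam ^ sInf {j | x j ≠ y j}

/-- `f` is a Walters function on `S` (for the metric with parameter `λ`): there is
`H : ℝ₊ → ℝ₊ ∪ {+∞}` increasing, null and continuous at zero, such that `d_k(x,y) ≤ s`
implies `|S_k f(x) - S_k f(y)| ≤ H(s)`. -/
def IsWalters {N : ℕ} (S : Set (ℕ → Fin N)) (lam : ℝ) (f : (ℕ → Fin N) → ℝ) : Prop :=
  ∃ H : ℝ → ENNReal, Monotone H ∧ H 0 = 0 ∧ Tendsto H (nhdsWithin 0 (Ioi 0)) (nhds 0) ∧
    ∀ s : ℝ, 0 ≤ s → ∀ k : ℕ, 0 < k → ∀ x ∈ S, ∀ y ∈ S,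
      (∀ j < k, sdist lam (Shift^[j] x) (Shift^[j] y) ≤ s) →
      ENNReal.ofReal |birkhoff k f x - birkhoff k f y| ≤ H s

/-- A function on the shift space is locally constant if it depends on finitely many
coordinates. -/
def LocallyConstantFn {N : ℕ} {E : Type*} (f : (ℕ → Fin N) → E) : Prop :=
  ∃ j : ℕ, ∀ x y : ℕ → Fin N, (∀ i ≤ j, x i = y i) → f x = f y

/-- The set `M_σ` of shift-invariant Borel probability measures giving full mass to the
subshift `S`. -/
def MS {N : ℕ} (S : Set (ℕ → Fin N)) : Set (ProbabilityMeasure (ℕ → Fin N)) :=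
  {μ | (μ : Measure (ℕ → Fin N)).map Shift = (μ : Measure (ℕ → Fin N)) ∧
    (μ : Measure (ℕ → Fin N)) S = 1}

/-- `μ` is a periodic probability measure of the subshift `S`: the uniform probability
measure on the orbit of a periodic point of `S`. -/
def IsPeriodicMeasure {N : ℕ} (S : Set (ℕ → Fin N)) (μ : ProbabilityMeasure (ℕ → Fin N)) :
    Prop :=
  ∃ z ∈ S, ∃ M : ℕ, 0 < M ∧ Shift^[M] z = z ∧
    (μ : Measure (ℕ → Fin N)) =
      (M : ENNReal)⁻¹ • ∑ j ∈ Finset.range M, Measure.dirac (Shift^[j] z)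

/-- `f` is joint recurrent with respect to the measure `ν`: for every measurable `D`,
`ν(Ξ(D)) = ν(D)`, where `Ξ(D)` is the set of `z ∈ D` such that for every `ε > 0` there is
`L > 0` with `σ^L(z) ∈ D` and `‖S_L f(z) - L f_*(ν)‖ < ε`. -/
def JointRec {N n : ℕ} (f : (ℕ → Fin N) → EuclideanSpace ℝ (Fin n))
    (ν : Measure (ℕ → Fin N)) : Prop :=
  ∀ D : Set (ℕ → Fin N), MeasurableSet D →
    ν {z ∈ D | ∀ ε > 0, ∃ L : ℕ, 0 < L ∧ Shift^[L] z ∈ D ∧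
      ‖birkhoff L f z - (L : ℝ) • ∫ x, f x ∂ν‖ < ε} = ν D

/-- The beta function of the subshift `S`:
`β_{A,φ}(r) = sup {∫A dμ : μ ∈ M_σ, φ_*(μ) = r}`. -/
noncomputable def betaS {N n : ℕ} (S : Set (ℕ → Fin N)) (A : (ℕ → Fin N) → ℝ)
    (φ : (ℕ → Fin N) → EuclideanSpace ℝ (Fin n)) (r : EuclideanSpace ℝ (Fin n)) : ℝ :=
  sSup {t : ℝ | ∃ μ ∈ MS S, ∫ x, φ x ∂(μ : Measure (ℕ → Fin N)) = r ∧
    ∫ x, A x ∂(μ : Measure (ℕ → Fin N)) = t}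

/-- The running maximum `max (0, S_1 g, …, S_n g)` of the Birkhoff sums of `g`. -/
noncomputable def birkhoffMax {X : Type*} (T : X → X) (g : X → ℝ) : ℕ → X → ℝ
  | 0 => fun _ => 0
  | n + 1 => fun x => max 0 (g x + birkhoffMax T g n (T x))

theorem birkhoffMax_nonneg {X : Type*} (T : X → X) (g : X → ℝ) (n : ℕ) (x : X) :
    0 ≤ birkhoffMax T g n x := by
  cases n with
  | zero => exact le_rfl
  | succ n => exact le_max_left _ _

theorem birkhoffMax_le_succ {X : Type*} (T : X → X) (g : X → ℝ) (n : ℕ) (x : X) :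
    birkhoffMax T g n x ≤ birkhoffMax T g (n + 1) x := by
  induction n generalizing x with
  | zero => exact birkhoffMax_nonneg T g 1 x
  | succ n ih => exact max_le_max le_rfl (by gcongr; exact ih _)

theorem birkhoffMax_mono {X : Type*} (T : X → X) (g : X → ℝ) (x : X) :
    Monotone fun n => birkhoffMax T g n x :=
  monotone_nat_of_le_succ fun n => birkhoffMax_le_succ T g n x

theorem birkhoffSum_le_birkhoffMax {X : Type*} (T : X → X) (g : X → ℝ) (n : ℕ) (x : X) :
    birkhoffSum T g n x ≤ birkhoffMax T g n x := by
  induction n generalizing x with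
  | zero => simp [birkhoffMax]
  | succ n ih =>
    rw [birkhoffSum_succ']
    exact le_trans (by gcongr; exact ih _) (le_max_right _ _)

theorem birkhoffMax_le {X : Type*} (T : X → X) (g : X → ℝ) {C : ℝ} (hC : ∀ x, |g x| ≤ C)
    (n : ℕ) (x : X) : birkhoffMax T g n x ≤ n * C := by
  induction n generalizing x with
  | zero => simp [birkhoffMax]
  | succ n ih =>
    have h0 : 0 ≤ C := (abs_nonneg _).trans (hC x)
    have h1 := ih (T x)
    have h2 := (le_abs_self _).trans (hC x)
    refine max_le (by positivity) ?_
    push_cast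
    linarith

theorem measurable_birkhoffMax {X : Type*} [MeasurableSpace X] {T : X → X} {g : X → ℝ}
    (hT : Measurable T) (hg : Measurable g) (n : ℕ) : Measurable (birkhoffMax T g n) := by
  induction n with
  | zero => exact measurable_const
  | succ n ih => exact measurable_const.max (hg.add (ih.comp hT))

/-- A form of the maximal ergodic theorem: if the Birkhoff sums of a bounded function are almost
everywhere unbounded above, its integral is nonnegative. -/
theorem integral_nonneg_of_birkhoffSum_unbounded {X : Type*} [MeasurableSpace X]
    {μ : Measure X} [IsProbabilityMeasure μ] {T : X → X} (hT : MeasurePreserving T μ μ)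
    {g : X → ℝ} (hg : Measurable g) {C : ℝ} (hC : ∀ x, |g x| ≤ C)
    (hun : ∀ᵐ x ∂μ, ∀ b : ℝ, ∃ n, b < birkhoffSum T g n x) : 0 ≤ ∫ x, g x ∂μ := by
  have hm := measurable_birkhoffMax hT.measurable hg
  have hint (n : ℕ) : Integrable (birkhoffMax T g n) μ :=
    Integrable.of_bound (hm n).aestronglyMeasurable (n * C) <| .of_forall fun x => by
      rw [Real.norm_of_nonneg (birkhoffMax_nonneg T g n x)]
      exact birkhoffMax_le T g hC n x
  have hcomp (n : ℕ) : Integrable (fun x => birkhoffMax T g n (T x)) μ :=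
    hT.integrable_comp_of_integrable (hint n)
  have heq (n : ℕ) (x : X) : birkhoffMax T g (n + 1) x - birkhoffMax T g n (T x) =
      max (-birkhoffMax T g n (T x)) (g x) := by
    simp only [birkhoffMax]
    rw [← max_sub_sub_right]
    simp
  have hnonneg (n : ℕ) : 0 ≤ ∫ x, max (-birkhoffMax T g n (T x)) (g x) ∂μ := by
    simp_rw [← heq]
    rw [integral_sub (hint _) (hcomp n)]
    have : ∫ x, birkhoffMax T g n (T x) ∂μ = ∫ x, birkhoffMax T g n x ∂μ := by
      conv_rhs => rw [← hT.map_eq]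
      rw [integral_map hT.aemeasurable (hm n).aestronglyMeasurable]
    rw [this, sub_nonneg]
    exact integral_mono (hint _) (hint _) (birkhoffMax_le_succ T g n)
  have hlim : Tendsto (fun n => ∫ x, max (-birkhoffMax T g n (T x)) (g x) ∂μ) atTop
      (𝓝 (∫ x, g x ∂μ)) := by
    refine tendsto_integral_of_dominated_convergence (fun _ => C) (fun n => ?_)
      (integrable_const C) (fun n => .of_forall fun x => ?_) ?_
    · exact (((hm n).comp hT.measurable).neg.max hg).aestronglyMeasurable
    · have h1 := birkhoffMax_nonneg T g n (T x)
      have h2 := abs_le.1 (hC x)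
      rw [Real.norm_eq_abs, abs_le]
      exact ⟨h2.1.trans (le_max_right _ _), max_le (by linarith) h2.2⟩
    · filter_upwards [hT.quasiMeasurePreserving.ae hun] with x hx
      obtain ⟨n, hn⟩ := hx (-g x)
      refine tendsto_const_nhds.congr' ?_
      filter_upwards [eventually_ge_atTop n] with m hm
      have h1 := birkhoffSum_le_birkhoffMax T g n (T x)
      have h2 := birkhoffMax_mono T g (T x) hm
      simp only at h2
      rw [max_eq_right (by linarith)]
  exact ge_of_tendsto' hlim hnonneg

/-- For an ergodic map and a bounded function of positive integral, the Birkhoff sums are almost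
everywhere bounded below. -/
theorem ae_bddBelow_birkhoffSum {X : Type*} [MeasurableSpace X]
    {μ : Measure X} [IsProbabilityMeasure μ] {T : X → X} (hT : Ergodic T μ)
    {f : X → ℝ} (hf : Measurable f) {C : ℝ} (hC : ∀ x, |f x| ≤ C)
    (hpos : 0 < ∫ x, f x ∂μ) : ∀ᵐ x ∂μ, ∃ b : ℝ, ∀ n, b ≤ birkhoffSum T f n x := by
  have hSm (n : ℕ) : Measurable (birkhoffSum T f n) := by
    unfold birkhoffSum
    exact Finset.measurable_sum _ fun k _ => hf.comp (hT.measurable.iterate k)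
  let B : Set X := {x | ∃ b : ℕ, ∀ n, -(b : ℝ) ≤ birkhoffSum T f n x}
  have hB : MeasurableSet B := by
    simp only [B, ofPred_exists, ofPred_forall]
    exact .iUnion fun b => .iInter fun n => measurableSet_le measurable_const (hSm n)
  have hmem (x : X) : x ∈ B ↔ ∃ b : ℝ, ∀ n, b ≤ birkhoffSum T f n x := by
    refine ⟨fun ⟨b, hb⟩ => ⟨_, hb⟩, fun ⟨b, hb⟩ => ?_⟩
    obtain ⟨m, hm⟩ := exists_nat_ge (-b)
    exact ⟨m, fun n => by linarith [hb n]⟩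
  have hinv : T ⁻¹' B = B := by
    ext x
    rw [mem_preimage, hmem, hmem]
    constructor
    · rintro ⟨b, hb⟩
      refine ⟨min 0 (f x + b), fun n => ?_⟩
      cases n with
      | zero => simp
      | succ n =>
        rw [birkhoffSum_succ']
        exact (min_le_right _ _).trans (by gcongr; exact hb n)
    · rintro ⟨b, hb⟩
      refine ⟨b - f x, fun n => ?_⟩
      have := hb (n + 1)
      rw [birkhoffSum_succ'] at this
      linarith
  rcases hT.prob_eq_zero_or_one hB hinv with h | h
  · exfalso
    have hn : ∀ᵐ x ∂μ, x ∉ B := measure_eq_zero_iff_ae_notMem.1 h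
    have := integral_nonneg_of_birkhoffSum_unbounded hT.toMeasurePreserving hf.neg (C := C)
      (fun x => by simpa using hC x) (by
        filter_upwards [hn] with x hx b
        rw [hmem] at hx
        push Not at hx
        obtain ⟨n, hn⟩ := hx (-b)
        refine ⟨n, ?_⟩
        simp only [birkhoffSum, Pi.neg_apply, Finset.sum_neg_distrib] at hn ⊢
        linarith)
    simp only [Pi.neg_apply, integral_neg] at this
    linarith
  · filter_upwards [(mem_ae_iff_prob_eq_one hB).2 h] with x hx
    exact (hmem x).1 hx

/-- For an ergodic map, a bounded function `f` and `c < ∫ f`, almost every point has all its long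
Birkhoff averages at least `c`. -/
theorem ae_eventually_mul_le_birkhoffSum {X : Type*} [MeasurableSpace X]
    {μ : Measure X} [IsProbabilityMeasure μ] {T : X → X} (hT : Ergodic T μ)
    {f : X → ℝ} (hf : Measurable f) {C : ℝ} (hC : ∀ x, |f x| ≤ C) {c : ℝ}
    (hc : c < ∫ x, f x ∂μ) :
    ∀ᵐ x ∂μ, ∃ n₀ : ℕ, ∀ n ≥ n₀, n * c ≤ birkhoffSum T f n x := by
  obtain ⟨c', hcc', hc'⟩ := exists_between hc
  have hfint : Integrable f μ :=
    Integrable.of_bound hf.aestronglyMeasurable C (.of_forall hC)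
  have := ae_bddBelow_birkhoffSum hT (f := fun x => f x - c') (hf.sub_const c') (C := C + |c'|)
    (fun x => (abs_sub _ _).trans (by gcongr; exact hC x))
    (by rw [integral_sub hfint (integrable_const _)]; simpa using hc')
  filter_upwards [this] with x ⟨b, hb⟩
  obtain ⟨m, hm⟩ := exists_nat_ge (-b / (c' - c))
  refine ⟨m, fun n hn => ?_⟩
  have h1 := hb n
  simp only [birkhoffSum, Finset.sum_sub_distrib, Finset.sum_const, Finset.card_range,
    nsmul_eq_mul] at h1 ⊢
  rw [div_le_iff₀ (by linarith)] at hm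
  have h2 : (m : ℝ) * (c' - c) ≤ n * (c' - c) := by
    have : (m : ℝ) ≤ n := by exact_mod_cast hn
    exact mul_le_mul_of_nonneg_right this (by linarith)
  linarith

/-- A finite set of rational numbers has a common denominator. -/
theorem exists_common_denominator {W : Set ℝ} (hW : W.Finite)
    (hQ : ∀ w ∈ W, ∃ q : ℚ, w = q) : ∃ d : ℕ, 0 < d ∧ ∀ w ∈ W, ∃ m : ℤ, (d : ℝ) * w = m := by
  induction W, hW using Set.Finite.induction_on with
  | empty => exact ⟨1, one_pos, by simp⟩
  | @insert a W _ _ ih =>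
    obtain ⟨d, hd, h⟩ := ih fun w hw => hQ w (mem_insert_of_mem _ hw)
    obtain ⟨q, rfl⟩ := hQ a (mem_insert _ _)
    refine ⟨q.den * d, Nat.mul_pos q.den_pos hd, ?_⟩
    rintro w (rfl | hw)
    · refine ⟨d * q.num, ?_⟩
      have : (q.den : ℝ) * q = q.num := by exact_mod_cast Rat.den_mul_eq_num q
      push_cast
      rw [← this]
      ring
    · obtain ⟨m, hm⟩ := h w hw
      refine ⟨q.den * m, ?_⟩
      push_cast
      rw [mul_assoc, hm]

theorem shift_iterate_apply {N : ℕ} (k : ℕ) (x : ℕ → Fin N) (i : ℕ) :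
    Shift^[k] x i = x (i + k) := by
  induction k generalizing x with
  | zero => rfl
  | succ k ih =>
    rw [Function.iterate_succ_apply, ih]
    simp only [Shift]
    congr 1

theorem measurable_shift {N : ℕ} : Measurable (Shift : (ℕ → Fin N) → ℕ → Fin N) :=
  measurable_pi_lambda _ fun i => measurable_pi_apply (i + 1)

theorem IsSubshiftFT.measurableSet {N : ℕ} {S : Set (ℕ → Fin N)} (hS : IsSubshiftFT S) :
    MeasurableSet S := by
  obtain ⟨M, rfl⟩ := hS
  rw [ofPred_forall]
  refine .iInter fun i => ?_
  have h : Measurable fun x : ℕ → Fin N => (x i, x (i + 1)) :=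
    (measurable_pi_apply i).prodMk (measurable_pi_apply (i + 1))
  exact h (MeasurableSet.of_discrete (s := {p : Fin N × Fin N | M p.1 p.2}))

theorem IsSubshiftFT.shift_iterate_mem {N : ℕ} {S : Set (ℕ → Fin N)} (hS : IsSubshiftFT S)
    {x : ℕ → Fin N} (hx : x ∈ S) (k : ℕ) : Shift^[k] x ∈ S := by
  obtain ⟨M, rfl⟩ := hS
  intro i
  rw [shift_iterate_apply, shift_iterate_apply, Nat.add_right_comm]
  exact hx (i + k)

theorem sdist_le_pow {N : ℕ} {lam : ℝ} (h0 : 0 < lam) (h1 : lam < 1) {K : ℕ}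
    {x y : ℕ → Fin N} (h : ∀ i < K, x i = y i) : sdist lam x y ≤ lam ^ K := by
  unfold sdist
  split_ifs with hxy
  · positivity
  · refine pow_le_pow_of_le_one h0.le h1.le ?_
    obtain ⟨i, hi⟩ := Function.ne_iff.1 hxy
    refine le_csInf ⟨i, hi⟩ fun j hj => ?_
    by_contra! hlt
    exact hj (h j hlt)

/-- Birkhoff sums of a Walters function over orbit segments that are sufficiently close in the
symbolic sense are uniformly close. -/
theorem IsWalters.exists_word_length {N : ℕ} {S : Set (ℕ → Fin N)} {lam : ℝ} (h0 : 0 < lam)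
    (h1 : lam < 1) {f : (ℕ → Fin N) → ℝ} (hf : IsWalters S lam f) {η : ℝ} (hη : 0 < η) :
    ∃ K₀ : ℕ, ∀ K ≥ K₀, ∀ k > 0, ∀ x ∈ S, ∀ y ∈ S, (∀ i < k + K, x i = y i) →
      |birkhoff k f x - birkhoff k f y| ≤ η := by
  obtain ⟨H, -, -, hlim, hH⟩ := hf
  have hpow : Tendsto (fun K : ℕ => lam ^ K) atTop (𝓝[>] 0) :=
    tendsto_nhdsWithin_iff.2 ⟨tendsto_pow_atTop_nhds_zero_of_lt_one h0.le h1,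
      .of_forall fun K => pow_pos h0 K⟩
  have hev := (hlim.comp hpow).eventually (gt_mem_nhds (ENNReal.ofReal_pos.2 hη))
  obtain ⟨K₀, hK₀⟩ := eventually_atTop.1 hev
  refine ⟨K₀, fun K hK k hk x hx y hy hxy => ?_⟩
  have := hH (lam ^ K) (by positivity) k hk x hx y hy fun j hj => sdist_le_pow h0 h1 fun i hi => by
    rw [shift_iterate_apply, shift_iterate_apply]
    exact hxy _ (by omega)
  exact (ENNReal.ofReal_le_ofReal_iff hη.le).1 (this.trans (hK₀ K hK).le)

theorem IsWalters.exists_bound {N : ℕ} {S : Set (ℕ → Fin N)} {lam : ℝ} (h0 : 0 < lam)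
    (h1 : lam < 1) {f : (ℕ → Fin N) → ℝ} (hf : IsWalters S lam f) :
    ∃ C : ℝ, ∀ x ∈ S, |f x| ≤ C := by
  obtain ⟨K, hK⟩ := hf.exists_word_length h0 h1 one_pos
  have hw : ∀ w : Fin (1 + K) → Fin N, ∃ b : ℝ, ∀ x ∈ S, (∀ i : Fin (1 + K), x i = w i) →
      |f x| ≤ b := by
    intro w
    by_cases hex : ∃ y ∈ S, ∀ i : Fin (1 + K), y i = w i
    · obtain ⟨y, hy, hyw⟩ := hex
      refine ⟨|f y| + 1, fun x hx hxw => ?_⟩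
      have := hK K le_rfl 1 one_pos x hx y hy fun i hi => by
        rw [hxw ⟨i, hi⟩, hyw ⟨i, hi⟩]
      simp only [birkhoff, Finset.sum_range_one, Function.iterate_zero, id] at this
      linarith [abs_sub_abs_le_abs_sub (f x) (f y)]
    · exact ⟨0, fun x hx hxw => absurd ⟨x, hx, hxw⟩ hex⟩
  choose b hb using hw
  obtain ⟨C, hC⟩ := (Set.finite_range b).bddAbove
  exact ⟨C, fun x hx => (hb (fun i => x i) x hx fun _ => rfl).trans (hC ⟨_, rfl⟩)⟩

theorem LocallyConstantFn.finite_range {N : ℕ} {E : Type*} {f : (ℕ → Fin N) → E}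
    (hf : LocallyConstantFn f) : (range f).Finite := by
  obtain ⟨j, hj⟩ := hf
  rcases isEmpty_or_nonempty (ℕ → Fin N) with h | ⟨⟨x₀⟩⟩
  · simp [range_eq_empty]
  · refine (Set.finite_range fun w : Fin (j + 1) → Fin N =>
      f fun i => if h : i < j + 1 then w ⟨i, h⟩ else x₀ i).subset ?_
    rintro _ ⟨x, rfl⟩
    refine ⟨fun i => x i, hj _ _ fun i hi => ?_⟩
    simp [Nat.lt_succ_of_le hi]

theorem LocallyConstantFn.birkhoff_eq {N : ℕ} {E : Type*} [AddCommMonoid E]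
    {f : (ℕ → Fin N) → E} (hf : LocallyConstantFn f) :
    ∃ K₀ : ℕ, ∀ K ≥ K₀, ∀ k, ∀ x y : ℕ → Fin N, (∀ i < k + K, x i = y i) →
      birkhoff k f x = birkhoff k f y := by
  obtain ⟨j, hj⟩ := hf
  refine ⟨j, fun K hK k x y hxy => Finset.sum_congr rfl fun l hl => hj _ _ fun i hi => ?_⟩
  rw [shift_iterate_apply, shift_iterate_apply]
  exact hxy _ (by have := Finset.mem_range.1 hl; omega)

/-- The sequence repeating periodically the first `L` letters of `z`. -/
def periodize {N : ℕ} (L : ℕ) (z : ℕ → Fin N) : ℕ → Fin N := fun i => z (i % L)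

theorem shift_iterate_periodize {N : ℕ} (L : ℕ) (z : ℕ → Fin N) :
    Shift^[L] (periodize L z) = periodize L z := by
  funext i
  rw [shift_iterate_apply]
  simp [periodize]

theorem periodize_eq {N L K : ℕ} (hL : 0 < L) {z : ℕ → Fin N}
    (hz : ∀ i < K, z (i + L) = z i) : ∀ i < L + K, periodize L z i = z i := by
  intro i
  induction i using Nat.strong_induction_on with
  | _ i ih =>
    intro hi
    by_cases h : i < L
    · simp [periodize, Nat.mod_eq_of_lt h]
    · obtain ⟨k, rfl⟩ := Nat.exists_eq_add_of_le' (not_lt.1 h)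
      rw [hz k (by omega), ← ih k (by omega) (by omega)]
      simp [periodize]

theorem IsSubshiftFT.periodize_mem {N : ℕ} {S : Set (ℕ → Fin N)} (hS : IsSubshiftFT S)
    {L K : ℕ} (hL : 0 < L) (hK : 0 < K) {z : ℕ → Fin N} (hzS : z ∈ S)
    (hz : ∀ i < K, z (i + L) = z i) : periodize L z ∈ S := by
  obtain ⟨M, rfl⟩ := hS
  intro i
  have hlt := Nat.mod_lt i hL
  have h : periodize L z (i + 1) = z (i % L + 1) := by
    rw [← periodize_eq hL hz (i % L + 1) (by omega)]
    simp [periodize]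
  rw [h]
  exact hzS (i % L)

/-- The uniform measure on the orbit segment of length `L` of `z`. -/
noncomputable def orbitMeasure {N : ℕ} (L : ℕ) (z : ℕ → Fin N) : Measure (ℕ → Fin N) :=
  (L : ENNReal)⁻¹ • ∑ j ∈ Finset.range L, Measure.dirac (Shift^[j] z)

theorem orbitMeasure_eq_one {N L : ℕ} (hL : 0 < L) {z : ℕ → Fin N} {s : Set (ℕ → Fin N)}
    (hs : MeasurableSet s) (h : ∀ j < L, Shift^[j] z ∈ s) : orbitMeasure L z s = 1 := by
  have : ∑ j ∈ Finset.range L, (Measure.dirac (Shift^[j] z) : Measure (ℕ → Fin N)) s = L := by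
    rw [Finset.sum_congr rfl (g := fun _ => 1) fun j hj => ?_]
    · simp
    · rw [Measure.dirac_apply' _ hs]
      simp [h j (Finset.mem_range.1 hj)]
  rw [orbitMeasure, Measure.smul_apply, Measure.finsetSum_apply, this, smul_eq_mul]
  exact ENNReal.inv_mul_cancel (by exact_mod_cast hL.ne') (ENNReal.natCast_ne_top L)

theorem isProbabilityMeasure_orbitMeasure {N L : ℕ} (hL : 0 < L) (z : ℕ → Fin N) :
    IsProbabilityMeasure (orbitMeasure L z) :=
  ⟨orbitMeasure_eq_one hL .univ fun _ _ => mem_univ _⟩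

theorem integral_orbitMeasure {N L : ℕ} {E : Type*} [NormedAddCommGroup E] [NormedSpace ℝ E]
    [CompleteSpace E] (z : ℕ → Fin N) (f : (ℕ → Fin N) → E) :
    ∫ x, f x ∂orbitMeasure L z = (L : ℝ)⁻¹ • birkhoff L f z := by
  rw [orbitMeasure, integral_smul_measure,
    integral_finsetSum_measure fun j _ => integrable_dirac (by simp)]
  simp [birkhoff]

theorem map_shift_orbitMeasure {N L : ℕ} {z : ℕ → Fin N} (hz : Shift^[L] z = z) :
    (orbitMeasure L z).map Shift = orbitMeasure L z := by
  have hsum : ∑ j ∈ Finset.range L, Measure.dirac (Shift^[j + 1] z) =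
      ∑ j ∈ Finset.range L, Measure.dirac (Shift^[j] z) := by
    cases L with
    | zero => simp
    | succ L =>
      rw [Finset.sum_range_succ, Finset.sum_range_succ' fun j => Measure.dirac (Shift^[j] z), hz,
        Function.iterate_zero, id]
  rw [orbitMeasure, Measure.map_smul]
  congr 1
  conv_rhs => rw [← hsum]
  ext s hs
  rw [Measure.map_apply measurable_shift hs, Measure.finsetSum_apply, Measure.finsetSum_apply]
  refine Finset.sum_congr rfl fun j _ => ?_
  rw [Function.iterate_succ_apply', ← Measure.map_dirac' measurable_shift (Shift^[j] z),
    Measure.map_apply measurable_shift hs]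

/-- If almost every point of `D` returns to `D` at a time `L > 0` with `S_L f = L • r`, then some
point of `D` has such returns at arbitrarily large times. -/
theorem exists_large_joint_return {X E : Type*} [MeasurableSpace X] [AddCommMonoid E]
    {μ : Measure X} [IsFiniteMeasure μ] {T : X → X} (hT : MeasurePreserving T μ μ)
    {D : Set X} (hD0 : μ D ≠ 0) (f : X → E) (r : E)
    (hRm : MeasurableSet {z ∈ D | ∃ L > 0, T^[L] z ∈ D ∧ birkhoffSum T f L z = L • r})
    (hR : μ D ≤ μ {z ∈ D | ∃ L > 0, T^[L] z ∈ D ∧ birkhoffSum T f L z = L • r}) :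
    ∃ z ∈ D, ∀ n : ℕ, ∃ L > n, T^[L] z ∈ D ∧ birkhoffSum T f L z = L • r := by
  set R := {z ∈ D | ∃ L > 0, T^[L] z ∈ D ∧ birkhoffSum T f L z = L • r} with hRdef
  have hsub : R ⊆ D := fun z hz => hz.1
  have hnull : μ (D \ R) = 0 := by
    rw [measure_sdiff hsub hRm.nullMeasurableSet (measure_ne_top _ _), tsub_eq_zero_of_le hR]
  have hae : ∀ᵐ z ∂μ, ∀ k : ℕ, T^[k] z ∉ D \ R :=
    ae_all_iff.2 fun k => (hT.iterate k).quasiMeasurePreserving.ae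
      (measure_eq_zero_iff_ae_notMem.1 hnull)
  obtain ⟨z, hzD, hz⟩ := Measure.exists_mem_of_measure_ne_zero_of_ae hD0
    (ae_restrict_of_ae (s := D) hae)
  have key (k : ℕ) (hk : T^[k] z ∈ D) : T^[k] z ∈ R := by
    by_contra h
    exact hz k ⟨hk, h⟩
  refine ⟨z, hzD, fun n => ?_⟩
  induction n with
  | zero => exact (key 0 hzD).2
  | succ n ih =>
    obtain ⟨L, hL, hLD, hLs⟩ := ih
    obtain ⟨-, L', hL', hLD', hLs'⟩ := key L hLD
    refine ⟨L + L', by omega, ?_, ?_⟩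
    · rwa [add_comm, Function.iterate_add_apply]
    · rw [birkhoffSum_add, hLs, hLs', add_smul]

/-- If a locally constant constraint and a rotation vector are rational, then joint recurrence
forces exact returns. -/
theorem JointRec.measure_exact_return {N n : ℕ} {φ : (ℕ → Fin N) → EuclideanSpace ℝ (Fin n)}
    (hφlc : LocallyConstantFn φ) (hφQ : ∀ x i, ∃ q : ℚ, φ x i = (q : ℝ))
    {ν : Measure (ℕ → Fin N)} (hrQ : ∀ i, ∃ q : ℚ, (∫ x, φ x ∂ν) i = (q : ℝ))
    (hjr : JointRec φ ν) {D : Set (ℕ → Fin N)} (hD : MeasurableSet D) :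
    ν D ≤ ν {z ∈ D | ∃ L > 0, Shift^[L] z ∈ D ∧
      birkhoffSum Shift φ L z = L • ∫ x, φ x ∂ν} := by
  obtain ⟨d, hd, hdW⟩ := exists_common_denominator
    (W := (⋃ i, (fun v : EuclideanSpace ℝ (Fin n) => v i) '' range φ) ∪
      range fun i => (∫ x, φ x ∂ν) i)
    ((finite_iUnion fun i => hφlc.finite_range.image _).union (finite_range _)) (by
      rintro w (hw | ⟨i, rfl⟩)
      · obtain ⟨i, hi⟩ := mem_iUnion.1 hw
        obtain ⟨_, ⟨x, rfl⟩, rfl⟩ := hi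
        exact hφQ x i
      · exact hrQ i)
  have hd' : (0 : ℝ) < d := by exact_mod_cast hd
  choose a ha using fun x i => hdW (φ x i) (Or.inl (mem_iUnion.2 ⟨i, φ x, ⟨x, rfl⟩, rfl⟩))
  choose b hb using fun i => hdW ((∫ x, φ x ∂ν) i) (Or.inr ⟨i, rfl⟩)
  rw [← hjr D hD]
  refine measure_mono fun z ⟨hzD, hz⟩ => ⟨hzD, ?_⟩
  obtain ⟨L, hL, hLD, hlt⟩ := hz (1 / d) (by positivity)
  refine ⟨L, hL, hLD, ?_⟩
  ext i
  have hi := (PiLp.norm_apply_le (birkhoff L φ z - (L : ℝ) • ∫ x, φ x ∂ν) i).trans_lt hlt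
  have hint : (d : ℝ) * (birkhoff L φ z - (L : ℝ) • ∫ x, φ x ∂ν) i =
      ((∑ j ∈ Finset.range L, a (Shift^[j] z) i - L * b i : ℤ) : ℝ) := by
    simp only [birkhoff, PiLp.sub_apply, PiLp.smul_apply, smul_eq_mul, WithLp.ofLp_sum,
      Finset.sum_apply]
    push_cast
    rw [← hb, mul_sub, Finset.mul_sum]
    simp_rw [ha]
    ring
  have habs : |(d : ℝ) * (birkhoff L φ z - (L : ℝ) • ∫ x, φ x ∂ν) i| < 1 := by
    rw [Real.norm_eq_abs, lt_div_iff₀ hd'] at hi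
    rw [abs_mul, abs_of_pos hd']
    linarith
  rw [hint, ← Int.cast_abs] at habs
  have hz0 := Int.abs_lt_one_iff.1 (by exact_mod_cast habs)
  rw [hz0, Int.cast_zero, mul_eq_zero, or_iff_right hd'.ne'] at hint
  simp only [PiLp.sub_apply, PiLp.smul_apply, smul_eq_mul, sub_eq_zero] at hint
  simpa [nsmul_eq_mul] using (show (birkhoffSum Shift φ L z) i = _ from hint)

/-- A periodic measure in the fiber almost realizes the integral of a Walters potential against an
ergodic measure for which the constraint is joint recurrent. -/
theorem exists_periodic_integral_ge {N n : ℕ} {S : Set (ℕ → Fin N)} (hS : IsSubshiftFT S)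
    {lam : ℝ} (hlam0 : 0 < lam) (hlam1 : lam < 1)
    {φ : (ℕ → Fin N) → EuclideanSpace ℝ (Fin n)} (hφm : Measurable φ)
    (hφlc : LocallyConstantFn φ) (hφQ : ∀ x i, ∃ q : ℚ, φ x i = (q : ℝ))
    {A : (ℕ → Fin N) → ℝ} (hAm : Measurable A) (hA : IsWalters S lam A)
    {ν : Measure (ℕ → Fin N)} [IsProbabilityMeasure ν] (hνS : ν S = 1)
    (hνerg : Ergodic Shift ν) (hrQ : ∀ i, ∃ q : ℚ, (∫ x, φ x ∂ν) i = (q : ℝ))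
    (hjr : JointRec φ ν) {c : ℝ} (hc : c < ∫ x, A x ∂ν) :
    ∃ μ ∈ MS S, IsPeriodicMeasure S μ ∧
      ∫ x, φ x ∂(μ : Measure (ℕ → Fin N)) = ∫ x, φ x ∂ν ∧
      c ≤ ∫ x, A x ∂(μ : Measure (ℕ → Fin N)) := by
  obtain ⟨c', hcc', hc'⟩ := exists_between hc
  have hSm := hS.measurableSet
  have hSae : ∀ᵐ x ∂ν, x ∈ S := (mem_ae_iff_prob_eq_one hSm).2 hνS
  obtain ⟨C, hC⟩ := hA.exists_bound hlam0 hlam1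
  obtain ⟨K₁, hK₁⟩ := hA.exists_word_length hlam0 hlam1 (sub_pos.2 hcc')
  obtain ⟨K₂, hK₂⟩ := hφlc.birkhoff_eq
  let K := K₁ + K₂ + 1
  have hind : ∫ x, S.indicator A x ∂ν = ∫ x, A x ∂ν :=
    integral_congr_ae (by
      filter_upwards [hSae] with x hx
      exact indicator_of_mem hx A)
  have hbirk (x : ℕ → Fin N) (hx : x ∈ S) (k : ℕ) :
      birkhoffSum Shift (S.indicator A) k x = birkhoff k A x :=
    Finset.sum_congr rfl fun j _ => indicator_of_mem (hS.shift_iterate_mem hx j) A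
  have hlow := ae_eventually_mul_le_birkhoffSum hνerg (hAm.indicator hSm) (C := max C 0)
    (fun x => by
      by_cases hx : x ∈ S
      · rw [indicator_of_mem hx]
        exact (hC x hx).trans (le_max_left _ _)
      · simp [indicator_of_notMem hx]) (c := c') (by rwa [hind])
  have hsumm {E : Type} [AddCommMonoid E] [MeasurableSpace E] [MeasurableAdd₂ E]
      {f : (ℕ → Fin N) → E} (hf : Measurable f) (k : ℕ) : Measurable (birkhoffSum Shift f k) := by
    unfold birkhoffSum
    exact Finset.measurable_sum _ fun j _ => hf.comp (measurable_shift.iterate j)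
  let D : ℕ × (Fin K → Fin N) → Set (ℕ → Fin N) := fun p =>
    S ∩ {x | (fun i : Fin K => x i) = p.2} ∩
      {x | ∀ m ≥ p.1, m * c' ≤ birkhoffSum Shift (S.indicator A) m x}
  have hDm (p) : MeasurableSet (D p) := by
    refine (hSm.inter ?_).inter ?_
    · exact (measurable_pi_lambda (fun (x : ℕ → Fin N) (i : Fin K) => x i)
        fun i => measurable_pi_apply _) (measurableSet_singleton p.2)
    · simp only [ofPred_forall]
      exact .iInter fun m => .iInter fun _ =>
        measurableSet_le measurable_const (hsumm (hAm.indicator hSm) m)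
  obtain ⟨p, hp⟩ : ∃ p, ν (D p) ≠ 0 := by
    by_contra! h
    have hnull : ν (⋃ p, D p) = 0 := measure_iUnion_null h
    have hne : ∀ᵐ x ∂ν, False := by
      filter_upwards [hSae, hlow, measure_eq_zero_iff_ae_notMem.1 hnull] with x hx ⟨m, hm⟩ hnot
      exact hnot (mem_iUnion.2 ⟨(m, fun i => x i), ⟨hx, rfl⟩, hm⟩)
    simp [IsProbabilityMeasure.ne_zero] at hne
  obtain ⟨z, ⟨⟨hzS, hzw⟩, hzlow⟩, hz⟩ := exists_large_joint_return hνerg.toMeasurePreserving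
    hp φ (∫ x, φ x ∂ν) (by
      have heq : {z ∈ D p | ∃ L > 0, Shift^[L] z ∈ D p ∧
          birkhoffSum Shift φ L z = L • ∫ x, φ x ∂ν} = D p ∩ ⋃ L : ℕ, ⋃ _ : L > 0,
          (Shift^[L] ⁻¹' D p ∩ birkhoffSum Shift φ L ⁻¹' {L • ∫ x, φ x ∂ν}) := by
        ext z
        simp [and_left_comm]
      rw [heq]
      exact (hDm p).inter <| .iUnion fun L => .iUnion fun _ =>
        ((measurable_shift.iterate L) (hDm p)).inter
          ((hsumm hφm L) (measurableSet_singleton _)))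
    (hjr.measure_exact_return hφlc hφQ hrQ (hDm p))
  obtain ⟨L, hL, ⟨⟨-, hLw⟩, -⟩, hLφ⟩ := hz p.1
  have hL0 : 0 < L := by omega
  have hret : ∀ i < K, z (i + L) = z i := fun i hi => by
    rw [← shift_iterate_apply L z i]
    exact congrFun ((show _ = p.2 from hLw).trans (show _ = p.2 from hzw).symm) ⟨i, hi⟩
  let w := periodize L z
  have hwS : w ∈ S := hS.periodize_mem hL0 (Nat.succ_pos _) hzS hret
  have hwz : ∀ i < L + K, w i = z i := periodize_eq hL0 hret
  have hper : Shift^[L] w = w := shift_iterate_periodize L z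
  have hL' : (0 : ℝ) < L := by exact_mod_cast hL0
  refine ⟨⟨orbitMeasure L w, isProbabilityMeasure_orbitMeasure hL0 w⟩,
    ⟨map_shift_orbitMeasure hper, orbitMeasure_eq_one hL0 hSm fun j _ =>
      hS.shift_iterate_mem hwS j⟩, ⟨w, hwS, L, hL0, hper, rfl⟩, ?_, ?_⟩
  · change ∫ x, φ x ∂orbitMeasure L w = _
    rw [integral_orbitMeasure, hK₂ K (by omega) L w z hwz]
    change (L : ℝ)⁻¹ • birkhoffSum Shift φ L z = _
    rw [hLφ, ← Nat.cast_smul_eq_nsmul ℝ, smul_smul, inv_mul_cancel₀ hL'.ne', one_smul]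
  · change c ≤ ∫ x, A x ∂orbitMeasure L w
    rw [integral_orbitMeasure, smul_eq_mul, ← div_eq_inv_mul, le_div_iff₀ hL']
    have h1 := hK₁ K (by omega) L hL0 w hwS z hzS hwz
    have h2 := hzlow L hL.le
    rw [hbirk z hzS] at h2
    have h3 : (1 : ℝ) ≤ L := by exact_mod_cast hL0
    nlinarith [(abs_le.1 h1).1]

/-- on a subshift of finite type, if `φ` is a locally constant constraint with
rational values, `A` a Walters potential, `r ∈ φ_*(M_σ) ∩ ℚ^n`, and there is an ergodic
`(A,r)`-maximizing probability with respect to which `φ` is joint recurrent, then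
`β_{A,φ}(r)` equals the supremum of `∫A dμ` over periodic probability measures `μ` in the
fiber `φ_*^{-1}(r)`. -/
theorem stmt15 {N n : ℕ} (S : Set (ℕ → Fin N)) (hS : IsSubshiftFT S)
    (lam : ℝ) (hlam0 : 0 < lam) (hlam1 : lam < 1)
    (φ : (ℕ → Fin N) → EuclideanSpace ℝ (Fin n)) (hφm : Measurable φ)
    (hφlc : LocallyConstantFn φ) (hφQ : ∀ x i, ∃ q : ℚ, φ x i = (q : ℝ))
    (A : (ℕ → Fin N) → ℝ) (hAm : Measurable A) (hA : IsWalters S lam A)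
    (r : EuclideanSpace ℝ (Fin n)) (hrQ : ∀ i, ∃ q : ℚ, r i = (q : ℝ))
    (ν : ProbabilityMeasure (ℕ → Fin N)) (hν : ν ∈ MS S)
    (hνerg : Ergodic Shift (ν : Measure (ℕ → Fin N)))
    (hνr : ∫ x, φ x ∂(ν : Measure (ℕ → Fin N)) = r)
    (hνmax : ∫ x, A x ∂(ν : Measure (ℕ → Fin N)) = betaS S A φ r)
    (hjr : JointRec φ (ν : Measure (ℕ → Fin N))) :
    betaS S A φ r = sSup {t : ℝ | ∃ μ ∈ MS S, IsPeriodicMeasure S μ ∧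
      ∫ x, φ x ∂(μ : Measure (ℕ → Fin N)) = r ∧
      ∫ x, A x ∂(μ : Measure (ℕ → Fin N)) = t} := by
  obtain ⟨C, hC⟩ := hA.exists_bound hlam0 hlam1
  have hbdd : BddAbove {t : ℝ | ∃ μ ∈ MS S, ∫ x, φ x ∂(μ : Measure (ℕ → Fin N)) = r ∧
      ∫ x, A x ∂(μ : Measure (ℕ → Fin N)) = t} := by
    refine ⟨C, ?_⟩
    rintro _ ⟨μ, hμ, -, rfl⟩
    refine (le_abs_self _).trans ?_
    have hae : ∀ᵐ x ∂(μ : Measure (ℕ → Fin N)), x ∈ S :=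
      (mem_ae_iff_prob_eq_one hS.measurableSet).2 hμ.2
    simpa using norm_integral_le_of_norm_le_const (f := A) (hae.mono hC)
  have hsub : {t : ℝ | ∃ μ ∈ MS S, IsPeriodicMeasure S μ ∧
      ∫ x, φ x ∂(μ : Measure (ℕ → Fin N)) = r ∧ ∫ x, A x ∂(μ : Measure (ℕ → Fin N)) = t} ⊆
      {t : ℝ | ∃ μ ∈ MS S, ∫ x, φ x ∂(μ : Measure (ℕ → Fin N)) = r ∧
      ∫ x, A x ∂(μ : Measure (ℕ → Fin N)) = t} := by
    rintro t ⟨μ, hμ, -, h⟩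
    exact ⟨μ, hμ, h⟩
  have hex (c : ℝ) (hc : c < betaS S A φ r) := exists_periodic_integral_ge hS hlam0 hlam1 hφm hφlc
    hφQ hAm hA hν.2 hνerg (by rwa [hνr]) hjr (hνmax ▸ hc)
  rw [hνr] at hex
  refine le_antisymm (le_of_forall_lt_imp_le_of_dense fun c hc => ?_) (csSup_le_csSup hbdd ?_ hsub)
  · obtain ⟨μ, hμ, hper, hφμ, hcμ⟩ := hex c hc
    exact hcμ.trans (le_csSup (hbdd.mono hsub) ⟨μ, hμ, hper, hφμ, rfl⟩)
  · obtain ⟨μ, hμ, hper, hφμ, -⟩ := hex (betaS S A φ r - 1) (by linarith)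
    exact ⟨_, μ, hμ, hper, hφμ, rfl⟩
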